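/- arXiv:1810.02263 — 2 statements merged into one kernel-verified Lean document; each statement's English description precedes it below -/
import Mathlib

section
/- For all real numbers a, b, t with 0 < b ≤ 4a and t > 0, one has 1 − e^{−at}/2 − (b/(4a))·(1 − e^{−at})/(1 − e^{−bt}) ≥ 0. -/
open Real

/-- Convexity of the exponential on `[-x, 0]`. -/
lemma mul_one_sub_exp_neg_le {c : ℝ} (hc₀ : 0 ≤ c) (hc₁ : c ≤ 1) (x : ℝ) :
    c * (1 - Real.exp (-x)) ≤ 1 - Real.exp (-(c * x)) := by
  have h := convexOn_exp.2 (Set.mem_univ (-x)) (Set.mem_univ 0) hc₀ (sub_nonneg.2 hc₁)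
    (by ring)
  simp only [smul_eq_mul, mul_zero, add_zero, Real.exp_zero, mul_neg] at h
  linarith

lemma one_sub_le_one_sub_half_mul {y : ℝ} (hy₀ : 0 ≤ y) (hy₁ : y ≤ 1) :
    1 - y ≤ (1 - y / 2) * (1 - y ^ 4) := by
  have h : 0 ≤ (1 - y) * (y * (1 + y + y ^ 2 * (1 - y))) := by
    have := sub_nonneg.2 hy₁
    positivity
  linarith

/-- For `0 < b ≤ 4a` and `t > 0`,
`1 − e^{−at}/2 − (b/(4a))·(1 − e^{−at})/(1 − e^{−bt}) ≥ 0`. -/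
theorem adam_elementary_inequality (a b t : ℝ) (hb : 0 < b) (hba : b ≤ 4 * a)
    (ht : 0 < t) :
    0 ≤ 1 - Real.exp (-(a * t)) / 2 -
      (b / (4 * a)) * ((1 - Real.exp (-(a * t))) / (1 - Real.exp (-(b * t)))) := by
  have ha : 0 < a := by linarith
  have hc₀ : 0 ≤ b / (4 * a) := by positivity
  have hc₁ : b / (4 * a) ≤ 1 := (div_le_one (by positivity)).2 hba
  have hE : 0 < 1 - Real.exp (-(b * t)) :=
    sub_pos.2 (Real.exp_lt_one_iff.2 (neg_lt_zero.2 (by positivity)))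
  have hy₁ : Real.exp (-(a * t)) ≤ 1 := Real.exp_le_one_iff.2 (neg_nonpos.2 (by positivity))
  have hconv := mul_one_sub_exp_neg_le hc₀ hc₁ (4 * a * t)
  have hpow : Real.exp (-(4 * a * t)) = Real.exp (-(a * t)) ^ 4 := by
    rw [← Real.exp_nat_mul]
    congr 1
    push_cast
    ring
  rw [hpow, show b / (4 * a) * (4 * a * t) = b * t by field_simp] at hconv
  rw [sub_nonneg, ← mul_div_assoc, div_le_iff₀ hE]
  calc b / (4 * a) * (1 - Real.exp (-(a * t)))
      ≤ b / (4 * a) * ((1 - Real.exp (-(a * t)) / 2) * (1 - Real.exp (-(a * t)) ^ 4)) :=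
        mul_le_mul_of_nonneg_left (one_sub_le_one_sub_half_mul (Real.exp_pos _).le hy₁) hc₀
    _ = (1 - Real.exp (-(a * t)) / 2) * (b / (4 * a) * (1 - Real.exp (-(a * t)) ^ 4)) := by ring
    _ ≤ (1 - Real.exp (-(a * t)) / 2) * (1 - Real.exp (-(b * t))) :=
        mul_le_mul_of_nonneg_left hconv (by linarith)
end

section
/- Let (α_n)_{n≥1} be a sequence in [0,1], define r₀ = 0 and r_n = α_n r_{n−1} + (1 − α_n), and suppose that γ_n = γ₀/(n+1)^κ for some γ₀ > 0 and κ ∈ (0, 1], and that (1 − α_n)/γ_n → a for some a > 0. Then: if κ ∈ (0,1), for all sufficiently large n one has 1 − r_n ≤ exp(−(aγ₀/(2(1−κ))) n^{1−κ}); and if κ = 1, then for every ε > 0 and all sufficiently large n one has 1 − r_n ≤ n^{−aγ₀/(1+ε)}. -/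
open Filter Topology

/-- A nonnegative sequence contracting by the factors `1 - δ n` decays eventually faster than
`exp (-ψ n)` as soon as the `δ n` dominate the increments of some `φ` with `φ - ψ → ∞`. -/
theorem eventually_le_exp_neg_of_contraction {s φ ψ δ : ℕ → ℝ} (hs : ∀ n, 0 ≤ s n)
    (hstep : ∀ n, s (n + 1) ≤ (1 - δ n) * s n)
    (hφ : ∀ᶠ n in atTop, φ (n + 1) - φ n ≤ δ n)
    (hdiv : Tendsto (fun n => φ n - ψ n) atTop atTop) :
    ∀ᶠ n in atTop, s n ≤ Real.exp (-ψ n) := by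
  obtain ⟨N, hN⟩ := eventually_atTop.1 hφ
  have hanti : ∀ n ≥ N, s n * Real.exp (φ n) ≤ s N * Real.exp (φ N) := by
    intro n hn
    induction n, hn using Nat.le_induction with
    | base => exact le_rfl
    | succ n hn ih =>
      refine le_trans ?_ ih
      calc s (n + 1) * Real.exp (φ (n + 1))
          ≤ (Real.exp (-δ n) * s n) * Real.exp (φ n + δ n) := by
            have h1 := Real.one_sub_le_exp_neg (δ n)
            have h2 : φ (n + 1) ≤ φ n + δ n := by linarith [hN n hn]
            have h3 := hs n
            have h4 : s (n + 1) ≤ Real.exp (-δ n) * s n :=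
              (hstep n).trans (mul_le_mul_of_nonneg_right h1 h3)
            gcongr
        _ = s n * Real.exp (φ n) := by
            rw [Real.exp_add, Real.exp_neg]
            field_simp
  have hlarge := (Real.tendsto_exp_atTop.comp hdiv).eventually_ge_atTop (s N * Real.exp (φ N))
  filter_upwards [hlarge, eventually_ge_atTop N] with n h1 h2
  have h3 : s n * Real.exp (φ n) ≤ Real.exp (-ψ n) * Real.exp (φ n) := by
    rw [← Real.exp_add, neg_add_eq_sub]
    exact (hanti n h2).trans h1
  exact le_of_mul_le_mul_right h3 (Real.exp_pos _)

/-- Tangent-line bound for the concave power `x ^ p`, `0 ≤ p ≤ 1`. -/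
theorem add_one_rpow_sub_rpow_le {x p : ℝ} (hx : 0 < x) (hp0 : 0 ≤ p) (hp1 : p ≤ 1) :
    (x + 1) ^ p - x ^ p ≤ p * x ^ (p - 1) := by
  have hinv : 0 < x⁻¹ := inv_pos.2 hx
  have h := rpow_one_add_le_one_add_mul_self (s := x⁻¹) (by linarith) hp0 hp1
  have hfac : (x + 1) ^ p = x ^ p * (1 + x⁻¹) ^ p := by
    rw [← Real.mul_rpow hx.le (by linarith)]
    congr 1
    field_simp
  have hpow : x ^ (p - 1) = x ^ p * x⁻¹ := by
    rw [Real.rpow_sub_one hx.ne', div_eq_mul_inv]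
  rw [hfac, hpow]
  nlinarith [mul_le_mul_of_nonneg_left h (Real.rpow_nonneg hx.le p)]

/-- Tangent-line bound for the logarithm. -/
theorem log_add_one_sub_log_le {x : ℝ} (hx : 0 < x) :
    Real.log (x + 1) - Real.log x ≤ 1 / x := by
  rw [← Real.log_div (by linarith) hx.ne']
  have h := Real.log_le_sub_one_of_pos (x := (x + 1) / x) (by positivity)
  have hx' : (x + 1) / x - 1 = 1 / x := by field_simp; ring
  linarith

/-- Rate of convergence of the debiasing sequence `rₙ` for polynomially
decaying stepsizes `γₙ = γ₀/(n+1)^κ`: if `κ < 1`, eventually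
`1 − rₙ ≤ exp(−(aγ₀/(2(1−κ))) n^(1−κ))`; if `κ = 1`, for every `ε > 0` eventually
`1 − rₙ ≤ n^(−aγ₀/(1+ε))`. -/
theorem adam_debias_sequence_rate (α : ℕ → ℝ) (hα : ∀ n, α n ∈ Set.Icc (0:ℝ) 1)
    (r : ℕ → ℝ) (hr0 : r 0 = 0)
    (hrec : ∀ n : ℕ, r (n + 1) = α (n + 1) * r n + (1 - α (n + 1)))
    (γ0 κ : ℝ) (hγ0 : 0 < γ0) (hκ : κ ∈ Set.Ioc (0:ℝ) 1)
    (γ : ℕ → ℝ) (hγ : ∀ n : ℕ, γ n = γ0 / ((n : ℝ) + 1) ^ κ)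
    (a : ℝ) (ha : 0 < a)
    (hlim : Tendsto (fun n => (1 - α n) / γ n) atTop (𝓝 a)) :
    (κ < 1 → ∃ N : ℕ, ∀ n ≥ N,
      1 - r n ≤ Real.exp (-(a * γ0 / (2 * (1 - κ))) * (n : ℝ) ^ (1 - κ))) ∧
    (κ = 1 → ∀ e : ℝ, 0 < e → ∃ N : ℕ, ∀ n ≥ N,
      1 - r n ≤ (n : ℝ) ^ (-(a * γ0 / (1 + e)))) := by
  have hs : ∀ n, 0 ≤ 1 - r n := by
    intro n
    induction n with
    | zero => simp [hr0]
    | succ n ih =>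
      rw [hrec]
      nlinarith [mul_nonneg (hα (n + 1)).1 ih]
  have hstep : ∀ n, 1 - r (n + 1) ≤ (1 - (1 - α (n + 1))) * (1 - r n) := by
    intro n
    rw [hrec]
    exact le_of_eq (by ring)
  have hlower : ∀ c < a, ∀ᶠ n : ℕ in atTop,
      c * (γ0 / ((n : ℝ) + 2) ^ κ) ≤ 1 - α (n + 1) := by
    intro c hc
    have h := (tendsto_add_atTop_iff_nat 1).2 hlim
    filter_upwards [h.eventually (lt_mem_nhds hc)] with n hn
    have hγn : γ (n + 1) = γ0 / ((n : ℝ) + 2) ^ κ := by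
      rw [hγ]
      push_cast
      ring_nf
    rw [hγn] at hn
    exact ((lt_div_iff₀ (by positivity)).1 hn).le
  refine ⟨fun hκ1 => ?_, fun hκ1 e he => ?_⟩
  · have hp : 0 < 1 - κ := by linarith
    set B := 3 / 4 * a * γ0 / (1 - κ) with hB
    have hBpos : 0 < B := by positivity
    have hBp : B * (1 - κ) = 3 / 4 * a * γ0 := by
      rw [hB]
      field_simp
    have hgap : 0 < B - a * γ0 / (2 * (1 - κ)) := by
      have : B - a * γ0 / (2 * (1 - κ)) = a * γ0 / (4 * (1 - κ)) := by
        rw [hB]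
        field_simp
        ring
      rw [this]
      positivity
    have key := eventually_le_exp_neg_of_contraction (s := fun n => 1 - r n)
      (φ := fun n => B * ((n : ℝ) + 2) ^ (1 - κ))
      (ψ := fun n => a * γ0 / (2 * (1 - κ)) * (n : ℝ) ^ (1 - κ))
      (δ := fun n => 1 - α (n + 1)) hs hstep ?_ ?_
    · simpa only [neg_mul] using eventually_atTop.1 key
    · filter_upwards [hlower (3 / 4 * a) (by linarith)] with n hn
      refine le_trans ?_ hn
      have hx : (0 : ℝ) < (n : ℝ) + 2 := by positivity
      have h := mul_le_mul_of_nonneg_left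
        (add_one_rpow_sub_rpow_le hx hp.le (by linarith [hκ.1])) hBpos.le
      rw [← mul_assoc, hBp, show 1 - κ - 1 = -κ by ring, Real.rpow_neg hx.le] at h
      push_cast
      rw [show (n : ℝ) + 1 + 2 = n + 2 + 1 by ring, ← mul_div_assoc, div_eq_mul_inv]
      linarith
    · refine tendsto_atTop_mono (fun n => ?_) (Tendsto.const_mul_atTop hgap
        ((tendsto_rpow_atTop hp).comp tendsto_natCast_atTop_atTop))
      have h : (n : ℝ) ^ (1 - κ) ≤ ((n : ℝ) + 2) ^ (1 - κ) :=
        Real.rpow_le_rpow (by positivity) (by linarith) hp.le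
      have h' := mul_le_mul_of_nonneg_left h hBpos.le
      simp only [Function.comp_apply]
      linarith
  · subst hκ1
    set c := a / (1 + e / 2) with hc
    have hcpos : 0 < c := by positivity
    have hca : c < a := div_lt_self ha (by linarith)
    have hgap : 0 < c * γ0 - a * γ0 / (1 + e) := by
      have : c * γ0 - a * γ0 / (1 + e) = (a / (1 + e / 2) - a / (1 + e)) * γ0 := by
        rw [hc]
        ring
      rw [this]
      refine mul_pos (sub_pos.2 ?_) hγ0
      exact div_lt_div_of_pos_left ha (by positivity) (by linarith)
    have key := eventually_le_exp_neg_of_contraction (s := fun n => 1 - r n)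
      (φ := fun n => c * γ0 * Real.log ((n : ℝ) + 2))
      (ψ := fun n => a * γ0 / (1 + e) * Real.log n)
      (δ := fun n => 1 - α (n + 1)) hs hstep ?_ ?_
    · refine eventually_atTop.1 ?_
      filter_upwards [key, eventually_gt_atTop 0] with n hn hn0
      rw [Real.rpow_def_of_pos (by exact_mod_cast hn0)]
      refine hn.trans_eq ?_
      congr 1
      ring
    · filter_upwards [hlower c hca] with n hn
      refine le_trans ?_ hn
      have hx : (0 : ℝ) < (n : ℝ) + 2 := by positivity
      have h := mul_le_mul_of_nonneg_left (log_add_one_sub_log_le hx) (mul_pos hcpos hγ0).le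
      push_cast
      rw [Real.rpow_one, show (n : ℝ) + 1 + 2 = n + 2 + 1 by ring]
      rw [mul_one_div, mul_div_assoc] at h
      linarith
    · refine tendsto_atTop_mono' _ ?_ (Tendsto.const_mul_atTop hgap
        (Real.tendsto_log_atTop.comp tendsto_natCast_atTop_atTop))
      filter_upwards [eventually_gt_atTop 0] with n hn0
      have hn0' : (0 : ℝ) < n := by exact_mod_cast hn0
      have h' := mul_le_mul_of_nonneg_left
        (Real.log_le_log hn0' (by linarith : (n : ℝ) ≤ n + 2)) (mul_pos hcpos hγ0).le
      simp only [Function.comp_apply]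
      linarith
end
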